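/- The subgroups Δ of index n in π₁(𝒢₆) isomorphic to π₁(𝒢₆) are in bijection with 6-tuples (k, ℓ, m, u, v, w) where k, ℓ, m are odd positive integers with kℓm = n and 0 ≤ v < m, 0 ≤ u < ℓ, 0 ≤ w < k. The subgroup corresponding to (k,ℓ,m,u,v,w) is generated by X = x^m y^{[1-k+2w]_{2k}} z^{[ℓ-1+2u]_{2ℓ}}, Y = y^k x^{[m-1+2v]_{2m}} z^{2u}, and Z = z^ℓ x^{2v} y^{2w}. -/

import Mathlib

/-- The relations of the Hantzsche–Wendt group:
`x y² x⁻¹ y² = 1`, `y x² y⁻¹ x² = 1`, `x y z = 1`, with `x, y, z` the generators `0, 1, 2`. -/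
def hwRels : Set (FreeGroup (Fin 3)) :=
  { FreeGroup.of 0 * FreeGroup.of 1 ^ 2 * (FreeGroup.of 0)⁻¹ * FreeGroup.of 1 ^ 2,
    FreeGroup.of 1 * FreeGroup.of 0 ^ 2 * (FreeGroup.of 1)⁻¹ * FreeGroup.of 0 ^ 2,
    FreeGroup.of 0 * FreeGroup.of 1 * FreeGroup.of 2 }

/-- The fundamental group of the Hantzsche–Wendt manifold `𝒢₆`. -/
abbrev HW : Type := PresentedGroup hwRels

def hwx : HW := PresentedGroup.of 0
def hwy : HW := PresentedGroup.of 1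
def hwz : HW := PresentedGroup.of 2

/-- The subgroup of `HW` generated by
`X = x^m y^{[1-k+2w]_{2k}} z^{[ℓ-1+2u]_{2ℓ}}`, `Y = y^k x^{[m-1+2v]_{2m}} z^{2u}`,
`Z = z^ℓ x^{2v} y^{2w}`, where `[r]_s` is the residue of `r` mod `s` in `[0, s)`. -/
def hwSub (t : ℕ × ℕ × ℕ × ℕ × ℕ × ℕ) : Subgroup HW :=
  match t with
  | (k, l, m, u, v, w) =>
    Subgroup.closure
      { hwx ^ (m : ℤ) * hwy ^ ((1 - (k : ℤ) + 2 * w) % (2 * k)) *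
          hwz ^ (((l : ℤ) - 1 + 2 * u) % (2 * l)),
        hwy ^ (k : ℤ) * hwx ^ (((m : ℤ) - 1 + 2 * v) % (2 * m)) * hwz ^ (2 * (u : ℤ)),
        hwz ^ (l : ℤ) * hwx ^ (2 * (v : ℤ)) * hwy ^ (2 * (w : ℤ)) }

/-- Admissible 6-tuples `(k, ℓ, m, u, v, w)` for index `n`. -/
def hwCond (n : ℕ) (t : ℕ × ℕ × ℕ × ℕ × ℕ × ℕ) : Prop :=
  match t with
  | (k, l, m, u, v, w) =>
    Odd k ∧ Odd l ∧ Odd m ∧ 0 < k ∧ 0 < l ∧ 0 < m ∧ k * l * m = n ∧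
      v < m ∧ u < l ∧ w < k

/-- The sign `(-1) ^ c`. -/
def paritySign (c : ℤ) : ℤ := 1 - 2 * (c % 2)

theorem paritySign_eq_or (c : ℤ) :
    c % 2 = 0 ∧ paritySign c = 1 ∨ c % 2 = 1 ∧ paritySign c = -1 := by
  unfold paritySign; omega

theorem paritySign_mul_emod_two (b c : ℤ) : (paritySign b * c) % 2 = c % 2 := by
  rcases paritySign_eq_or b with h | h <;> rw [h.2] <;> omega

theorem paritySign_congr {c d : ℤ} (h : c % 2 = d % 2) : paritySign c = paritySign d := by
  unfold paritySign; rw [h]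

theorem paritySign_add (c d : ℤ) : paritySign (c + d) = paritySign c * paritySign d := by
  rcases paritySign_eq_or c with h | h <;> rcases paritySign_eq_or d with h' | h' <;>
    rw [h.2, h'.2] <;> unfold paritySign <;> omega

@[simp] theorem paritySign_mul (b c : ℤ) : paritySign (paritySign b * c) = paritySign c :=
  paritySign_congr (paritySign_mul_emod_two b c)

@[simp] theorem paritySign_neg (c : ℤ) : paritySign (-c) = paritySign c :=
  paritySign_congr (by omega)

/-- The group of affine maps of `ℤ³` with translation part `(a, b, c)` and linear part
`diag ((-1)^c, (-1)^a, (-1)^b)`. It contains the Hantzsche–Wendt group with index two. -/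
@[ext] structure HWAffine where
  a : ℤ
  b : ℤ
  c : ℤ

namespace HWAffine

instance : Mul HWAffine :=
  ⟨fun p q => ⟨p.a + paritySign p.c * q.a, p.b + paritySign p.a * q.b,
    p.c + paritySign p.b * q.c⟩⟩
instance : One HWAffine := ⟨⟨0, 0, 0⟩⟩
instance : Inv HWAffine :=
  ⟨fun p => ⟨-(paritySign p.c * p.a), -(paritySign p.a * p.b), -(paritySign p.b * p.c)⟩⟩

@[simp] theorem mul_a (p q : HWAffine) : (p * q).a = p.a + paritySign p.c * q.a := rfl
@[simp] theorem mul_b (p q : HWAffine) : (p * q).b = p.b + paritySign p.a * q.b := rfl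
@[simp] theorem mul_c (p q : HWAffine) : (p * q).c = p.c + paritySign p.b * q.c := rfl
@[simp] theorem one_a : (1 : HWAffine).a = 0 := rfl
@[simp] theorem one_b : (1 : HWAffine).b = 0 := rfl
@[simp] theorem one_c : (1 : HWAffine).c = 0 := rfl
@[simp] theorem inv_a (p : HWAffine) : p⁻¹.a = -(paritySign p.c * p.a) := rfl
@[simp] theorem inv_b (p : HWAffine) : p⁻¹.b = -(paritySign p.a * p.b) := rfl
@[simp] theorem inv_c (p : HWAffine) : p⁻¹.c = -(paritySign p.b * p.c) := rfl

instance : Group HWAffine :=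
  Group.ofLeftAxioms
    (fun p q r => by ext <;> simp [paritySign_add] <;> ring)
    (fun p => by ext <;> simp [paritySign])
    (fun p => by ext <;> simp)

/-- A translation has all coordinates even. -/
def IsTranslation (p : HWAffine) : Prop := p.a % 2 = 0 ∧ p.b % 2 = 0 ∧ p.c % 2 = 0

/-- Elements acting as half-turn screw motions along the first axis. -/
def IsScrewA (p : HWAffine) : Prop := p.a % 2 = 1 ∧ p.b % 2 = 1 ∧ p.c % 2 = 0

/-- Elements acting as half-turn screw motions along the second axis. -/
def IsScrewB (p : HWAffine) : Prop := p.a % 2 = 0 ∧ p.b % 2 = 1 ∧ p.c % 2 = 1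

/-- Elements acting as half-turn screw motions along the third axis. -/
def IsScrewC (p : HWAffine) : Prop := p.a % 2 = 1 ∧ p.b % 2 = 0 ∧ p.c % 2 = 1

theorem mul_a_emod_two (p q : HWAffine) : (p * q).a % 2 = (p.a + q.a) % 2 := by
  have := paritySign_mul_emod_two p.c q.a
  simp only [mul_a]; omega

theorem mul_b_emod_two (p q : HWAffine) : (p * q).b % 2 = (p.b + q.b) % 2 := by
  have := paritySign_mul_emod_two p.a q.b
  simp only [mul_b]; omega

theorem mul_c_emod_two (p q : HWAffine) : (p * q).c % 2 = (p.c + q.c) % 2 := by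
  have := paritySign_mul_emod_two p.b q.c
  simp only [mul_c]; omega

theorem inv_a_emod_two (p : HWAffine) : p⁻¹.a % 2 = p.a % 2 := by
  have := paritySign_mul_emod_two p.c p.a
  simp only [inv_a]; omega

theorem inv_b_emod_two (p : HWAffine) : p⁻¹.b % 2 = p.b % 2 := by
  have := paritySign_mul_emod_two p.a p.b
  simp only [inv_b]; omega

theorem inv_c_emod_two (p : HWAffine) : p⁻¹.c % 2 = p.c % 2 := by
  have := paritySign_mul_emod_two p.b p.c
  simp only [inv_c]; omega

theorem IsTranslation.mul_eq {p : HWAffine} (hp : p.IsTranslation) (q : HWAffine) :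
    p * q = ⟨p.a + q.a, p.b + q.b, p.c + q.c⟩ := by
  obtain ⟨h1, h2, h3⟩ := hp
  ext <;> simp [paritySign, *]

theorem IsTranslation.mul_comm {p q : HWAffine} (hp : p.IsTranslation) (hq : q.IsTranslation) :
    p * q = q * p := by
  rw [hp.mul_eq, hq.mul_eq]; ext <;> simp [add_comm]

theorem IsTranslation.mul {p q : HWAffine} (hp : p.IsTranslation) (hq : q.IsTranslation) :
    (p * q).IsTranslation := by
  rw [hp.mul_eq]
  obtain ⟨h1, h2, h3⟩ := hp
  obtain ⟨h4, h5, h6⟩ := hq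
  refine ⟨?_, ?_, ?_⟩ <;> dsimp only <;> omega

theorem IsTranslation.of_mul {p q : HWAffine} (hp : p.IsTranslation)
    (hpq : (p * q).IsTranslation) : q.IsTranslation := by
  rw [hp.mul_eq] at hpq
  obtain ⟨h1, h2, h3⟩ := hp
  obtain ⟨h4, h5, h6⟩ := hpq
  dsimp only at h4 h5 h6
  refine ⟨?_, ?_, ?_⟩ <;> omega

theorem translation_zpow (a b c : ℤ) (n : ℤ) :
    (⟨2 * a, 2 * b, 2 * c⟩ : HWAffine) ^ n = ⟨2 * (n * a), 2 * (n * b), 2 * (n * c)⟩ := by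
  have key : ∀ a b c : ℤ, (⟨2 * a, 2 * b, 2 * c⟩ : HWAffine).IsTranslation :=
    fun a b c => ⟨by simp, by simp, by simp⟩
  induction n with
  | zero => ext <;> simp
  | succ n ih =>
    rw [zpow_add_one, ih, (key _ _ _).mul_eq]; ext <;> simp <;> ring
  | pred n ih =>
    rw [zpow_sub_one, ih, (key _ _ _).mul_eq]; ext <;> simp [paritySign] <;> ring

theorem IsScrewA.zpow_two_mul {p : HWAffine} (hp : p.IsScrewA) (n : ℤ) :
    p ^ (2 * n) = ⟨2 * (n * p.a), 0, 0⟩ := by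
  obtain ⟨h1, h2, h3⟩ := hp
  have : p ^ (2 : ℤ) = ⟨2 * p.a, 2 * 0, 2 * 0⟩ := by
    rw [zpow_two]; ext <;> simp [paritySign, *]; ring
  rw [zpow_mul, this, translation_zpow]; simp

theorem IsScrewB.zpow_two_mul {p : HWAffine} (hp : p.IsScrewB) (n : ℤ) :
    p ^ (2 * n) = ⟨0, 2 * (n * p.b), 0⟩ := by
  obtain ⟨h1, h2, h3⟩ := hp
  have : p ^ (2 : ℤ) = ⟨2 * 0, 2 * p.b, 2 * 0⟩ := by
    rw [zpow_two]; ext <;> simp [paritySign, *]; ring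
  rw [zpow_mul, this, translation_zpow]; simp

theorem IsScrewC.zpow_two_mul {p : HWAffine} (hp : p.IsScrewC) (n : ℤ) :
    p ^ (2 * n) = ⟨0, 0, 2 * (n * p.c)⟩ := by
  obtain ⟨h1, h2, h3⟩ := hp
  have : p ^ (2 : ℤ) = ⟨2 * 0, 2 * 0, 2 * p.c⟩ := by
    rw [zpow_two]; ext <;> simp [paritySign, *]; ring
  rw [zpow_mul, this, translation_zpow]; simp

/-- Scaling the axes by odd `m`, `k`, `l`, followed by conjugation by translation by `(s, t, r)`. -/
def scale {m k l : ℤ} (hm : m % 2 = 1) (hk : k % 2 = 1) (hl : l % 2 = 1) (s t r : ℤ) :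
    HWAffine →* HWAffine :=
  have key : ∀ {m : ℤ} (s a c : ℤ), m % 2 = 1 →
      paritySign (m * a + 2 * s * (c % 2)) = paritySign a := fun s a c h =>
    paritySign_congr (by rw [mul_assoc 2]; simp [Int.add_emod, Int.mul_emod, h])
  MonoidHom.mk'
    (fun p => ⟨m * p.a + 2 * s * (p.c % 2), k * p.b + 2 * t * (p.a % 2),
      l * p.c + 2 * r * (p.b % 2)⟩)
    (fun p q => by
      have aux : ∀ m s a b c d : ℤ, m * (a + paritySign c * b) + 2 * s * ((c + d) % 2) =
          m * a + 2 * s * (c % 2) + paritySign c * (m * b + 2 * s * (d % 2)) := by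
        intro m s a b c d
        rcases paritySign_eq_or c with h | h <;> rcases paritySign_eq_or d with h' | h' <;>
          simp [Int.add_emod, h, h'] <;> ring
      ext
      · simp only [mul_a, mul_c_emod_two, key r p.c p.b hl, aux]
      · simp only [mul_b, mul_a_emod_two, key s p.a p.c hm, aux]
      · simp only [mul_c, mul_b_emod_two, key t p.b p.a hk, aux])

theorem scale_injective {m k l : ℤ} (hm : m % 2 = 1) (hk : k % 2 = 1) (hl : l % 2 = 1)
    (s t r : ℤ) : Function.Injective (scale hm hk hl s t r) := by
  refine (injective_iff_map_eq_one _).2 fun p hp => ?_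
  have ha : m * p.a + 2 * s * (p.c % 2) = 0 := congrArg a hp
  have hb : k * p.b + 2 * t * (p.a % 2) = 0 := congrArg b hp
  have hc : l * p.c + 2 * r * (p.b % 2) = 0 := congrArg c hp
  have even : ∀ m s a c : ℤ, m % 2 = 1 → m * a + 2 * s * (c % 2) = 0 → a % 2 = 0 := by
    intro m s a c hm h
    have := congrArg (· % 2) h
    rw [mul_assoc 2] at this
    simpa [Int.add_emod, Int.mul_emod, hm] using this
  have h1 := even _ _ _ _ hm ha
  have h2 := even _ _ _ _ hk hb
  have h3 := even _ _ _ _ hl hc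
  rw [h3] at ha
  rw [h1] at hb
  rw [h2] at hc
  have hm0 : m ≠ 0 := by omega
  have hk0 : k ≠ 0 := by omega
  have hl0 : l ≠ 0 := by omega
  ext <;> simp_all

end HWAffine

theorem hwx_conj_sq : hwx * hwy ^ 2 * hwx⁻¹ * hwy ^ 2 = 1 :=
  PresentedGroup.one_of_mem (rels := hwRels) (Or.inl rfl)

theorem hwy_conj_sq : hwy * hwx ^ 2 * hwy⁻¹ * hwx ^ 2 = 1 :=
  PresentedGroup.one_of_mem (rels := hwRels) (Or.inr (Or.inl rfl))

theorem hwx_mul_hwy_mul_hwz : hwx * hwy * hwz = 1 :=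
  PresentedGroup.one_of_mem (rels := hwRels) (Or.inr (Or.inr rfl))

theorem hwz_eq : hwz = hwy⁻¹ * hwx⁻¹ := by
  rw [← mul_inv_rev]; exact eq_inv_of_mul_eq_one_right hwx_mul_hwy_mul_hwz

theorem mul_zpow_of_mul_eq_inv_mul {G : Type*} [Group G] {g t : G} (h : g * t = t⁻¹ * g) (n : ℤ) :
    g * t ^ n = t ^ (-n) * g := by
  have : SemiconjBy g t t⁻¹ := h
  simpa using (this.zpow_right n).eq

theorem hwx_mul_hwy_sq : hwx * hwy ^ 2 = (hwy ^ 2)⁻¹ * hwx := by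
  rw [← mul_inv_eq_iff_eq_mul]; exact eq_inv_of_mul_eq_one_left hwx_conj_sq

theorem hwy_mul_hwx_sq : hwy * hwx ^ 2 = (hwx ^ 2)⁻¹ * hwy := by
  rw [← mul_inv_eq_iff_eq_mul]; exact eq_inv_of_mul_eq_one_left hwy_conj_sq

theorem commute_of_mul_eq_inv_mul {G : Type*} [Group G] {g t : G} (h : g * t = t⁻¹ * g) :
    Commute (g ^ 2) t := by
  have h' : SemiconjBy g t t⁻¹ := h
  have h'' : SemiconjBy g t⁻¹ t := by simpa using h'.inv_right
  rw [pow_two]; exact h''.mul_left h'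

theorem commute_hwx_sq_hwy_sq : Commute (hwx ^ 2) (hwy ^ 2) :=
  commute_of_mul_eq_inv_mul hwx_mul_hwy_sq

theorem hwx_mul_hwz_sq : hwx * hwz ^ 2 = (hwz ^ 2)⁻¹ * hwx := by
  have h1 : hwy ^ 2 * hwx = hwx * (hwy ^ 2)⁻¹ := by
    rw [eq_mul_inv_iff_mul_eq, mul_assoc, hwx_mul_hwy_sq]; group
  have h2 : hwx * (hwx * hwy) ^ 2 = ((hwx * hwy) ^ 2)⁻¹ * hwx := by
    rw [eq_inv_mul_iff_mul_eq]
    have e : hwy * (hwy * hwx) = hwx * (hwy ^ 2)⁻¹ := by rw [← h1, pow_two, mul_assoc]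
    calc (hwx * hwy) ^ 2 * (hwx * (hwx * hwy) ^ 2)
        = hwx * hwy * hwx * (hwy * hwx ^ 2) * (hwy * hwx) * hwy := by
          simp only [pow_two, mul_assoc]
      _ = hwx * hwy * hwx⁻¹ * (hwy * (hwy * hwx)) * hwy := by
          rw [hwy_mul_hwx_sq]; simp only [pow_two, mul_assoc, mul_inv_rev]; group
      _ = hwx := by rw [e]; group
  have h3 : hwz ^ 2 = ((hwx * hwy) ^ 2)⁻¹ := by rw [hwz_eq, ← mul_inv_rev, inv_pow]
  rw [h3, inv_inv, mul_inv_eq_iff_eq_mul, mul_assoc, h2]; group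

theorem hwy_mul_hwz_sq : hwy * hwz ^ 2 = (hwz ^ 2)⁻¹ * hwy := by
  have e : hwy = hwx⁻¹ * hwz⁻¹ := by rw [hwz_eq]; group
  have h1 : SemiconjBy hwx (hwz ^ 2) (hwz ^ 2)⁻¹ := hwx_mul_hwz_sq
  have h2 : SemiconjBy hwx⁻¹ (hwz ^ 2) (hwz ^ 2)⁻¹ := by simpa using h1.inv_symm_left.inv_right
  have h3 : SemiconjBy hwz⁻¹ (hwz ^ 2) (hwz ^ 2) := ((Commute.refl hwz).pow_right 2).inv_left
  rw [e]; exact h2.mul_left h3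

/-- The translation `x ^ (2 i) y ^ (2 j) z ^ (2 k)`. -/
def hwTrans (i j k : ℤ) : HW := hwx ^ (2 * i) * hwy ^ (2 * j) * hwz ^ (2 * k)

theorem hwTrans_eq (i j k : ℤ) :
    hwTrans i j k = (hwx ^ 2) ^ i * (hwy ^ 2) ^ j * (hwz ^ 2) ^ k := by
  unfold hwTrans
  rw [zpow_mul, zpow_mul, zpow_mul]; rfl

theorem hwTrans_mul (i j k i' j' k' : ℤ) :
    hwTrans i j k * hwTrans i' j' k' = hwTrans (i + i') (j + j') (k + k') := by
  have hAB := (commute_hwx_sq_hwy_sq.zpow_zpow i' j).eq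
  have hAC := ((commute_of_mul_eq_inv_mul hwx_mul_hwz_sq).zpow_zpow i' k).eq
  have hBC := ((commute_of_mul_eq_inv_mul hwy_mul_hwz_sq).zpow_zpow j' k).eq
  simp only [hwTrans_eq, zpow_add]
  generalize (hwx ^ 2) ^ i' = A' at *
  generalize (hwz ^ 2) ^ k = C at *
  generalize (hwy ^ 2) ^ j = B at *
  generalize (hwy ^ 2) ^ j' = B' at *
  simp only [mul_assoc]
  rw [← mul_assoc C A', ← hAC, mul_assoc A', ← mul_assoc B, ← hAB, ← mul_assoc C, ← hBC]
  simp only [mul_assoc]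

theorem hwx_mul_hwTrans (i j k : ℤ) : hwx * hwTrans i j k = hwTrans i (-j) (-k) * hwx := by
  simp only [hwTrans_eq]
  rw [← mul_assoc, ← mul_assoc, (((Commute.refl hwx).pow_right 2).zpow_right i).eq, mul_assoc _ hwx,
    mul_zpow_of_mul_eq_inv_mul hwx_mul_hwy_sq, ← mul_assoc, mul_assoc _ hwx,
    mul_zpow_of_mul_eq_inv_mul hwx_mul_hwz_sq, ← mul_assoc]

theorem hwy_mul_hwTrans (i j k : ℤ) : hwy * hwTrans i j k = hwTrans (-i) j (-k) * hwy := by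
  simp only [hwTrans_eq]
  rw [← mul_assoc, ← mul_assoc, mul_zpow_of_mul_eq_inv_mul hwy_mul_hwx_sq, mul_assoc _ hwy,
    (((Commute.refl hwy).pow_right 2).zpow_right j).eq, ← mul_assoc, mul_assoc _ hwy,
    mul_zpow_of_mul_eq_inv_mul hwy_mul_hwz_sq, ← mul_assoc]

theorem hw_normal_form (g : HW) : ∃ i j k : ℤ, ∃ w : HW,
    (w = 1 ∨ w = hwx ∨ w = hwy ∨ w = hwz) ∧ g = hwTrans i j k * w := by
  let N : Set HW := {g | ∃ i j k : ℤ, ∃ w : HW,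
    (w = 1 ∨ w = hwx ∨ w = hwy ∨ w = hwz) ∧ g = hwTrans i j k * w}
  have hT : ∀ i j k, ∀ g ∈ N, hwTrans i j k * g ∈ N := by
    rintro i j k _ ⟨i', j', k', w, hw, rfl⟩
    exact ⟨_, _, _, w, hw, by rw [← mul_assoc, hwTrans_mul]⟩
  have hw : ∀ w, (w = 1 ∨ w = hwx ∨ w = hwy ∨ w = hwz) → w ∈ N := fun w hw =>
    ⟨0, 0, 0, w, hw, by simp [hwTrans]⟩
  have e1 : hwx * hwx = hwTrans 1 0 0 * 1 := by simp [hwTrans_eq, pow_two]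
  have e2 : hwx * hwy = hwTrans 0 0 (-1) * hwz := by
    simp [hwTrans_eq, pow_two, hwz_eq, mul_assoc]
  have e3 : hwx * hwz = hwTrans 1 0 (-1) * hwy := by
    have h : hwx * hwz = hwx * hwz ^ 2 * hwx * hwy := by
      rw [mul_assoc _ hwx, eq_inv_of_mul_eq_one_left hwx_mul_hwy_mul_hwz]; simp [pow_two, mul_assoc]
    have h' := ((commute_of_mul_eq_inv_mul hwx_mul_hwz_sq).inv_right).eq
    rw [h, hwx_mul_hwz_sq, mul_assoc _ hwx hwx, ← pow_two, ← h']
    simp [hwTrans_eq]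
  have e4 : hwy * hwx = hwTrans (-1) 1 0 * hwz := by
    have h : hwy * hwx = hwy * (hwy * hwz) * hwx ^ 2 := by
      rw [hwz_eq]; simp [pow_two]
    have h' : hwz * hwx ^ 2 = (hwx ^ 2)⁻¹ * hwz := by
      have h1 : SemiconjBy hwy (hwx ^ 2) (hwx ^ 2)⁻¹ := hwy_mul_hwx_sq
      have h2 : SemiconjBy hwy⁻¹ (hwx ^ 2) (hwx ^ 2)⁻¹ := by
        simpa using h1.inv_symm_left.inv_right
      have h3 : SemiconjBy hwx⁻¹ (hwx ^ 2) (hwx ^ 2) := ((Commute.refl hwx).pow_right 2).inv_left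
      rw [hwz_eq]; exact h2.mul_left h3
    have h4 := (commute_hwx_sq_hwy_sq.inv_left).eq
    rw [h, mul_assoc, mul_assoc, h', ← mul_assoc, ← mul_assoc, ← pow_two, ← h4]
    simp [hwTrans_eq]
  have e5 : hwy * hwy = hwTrans 0 1 0 * 1 := by simp [hwTrans_eq, pow_two]
  have e6 : hwy * hwz = hwTrans (-1) 0 0 * hwx := by
    simp [hwTrans_eq, pow_two, hwz_eq]
  have hx : ∀ g ∈ N, hwx * g ∈ N := by
    rintro _ ⟨i, j, k, w, hw', rfl⟩
    rw [← mul_assoc, hwx_mul_hwTrans, mul_assoc]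
    refine hT _ _ _ _ ?_
    rcases hw' with rfl | rfl | rfl | rfl
    · rw [mul_one]; exact hw _ (by simp)
    · rw [e1]; exact hT _ _ _ _ (hw _ (by simp))
    · rw [e2]; exact hT _ _ _ _ (hw _ (by simp))
    · rw [e3]; exact hT _ _ _ _ (hw _ (by simp))
  have hy : ∀ g ∈ N, hwy * g ∈ N := by
    rintro _ ⟨i, j, k, w, hw', rfl⟩
    rw [← mul_assoc, hwy_mul_hwTrans, mul_assoc]
    refine hT _ _ _ _ ?_
    rcases hw' with rfl | rfl | rfl | rfl
    · rw [mul_one]; exact hw _ (by simp)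
    · rw [e4]; exact hT _ _ _ _ (hw _ (by simp))
    · rw [e5]; exact hT _ _ _ _ (hw _ (by simp))
    · rw [e6]; exact hT _ _ _ _ (hw _ (by simp))
  have hx' : ∀ g ∈ N, hwx⁻¹ * g ∈ N := fun g hg => by
    have : hwx⁻¹ = hwTrans (-1) 0 0 * hwx := by simp [hwTrans_eq, pow_two]
    rw [this, mul_assoc]; exact hT _ _ _ _ (hx g hg)
  have hy' : ∀ g ∈ N, hwy⁻¹ * g ∈ N := fun g hg => by
    have : hwy⁻¹ = hwTrans 0 (-1) 0 * hwy := by simp [hwTrans_eq, pow_two]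
    rw [this, mul_assoc]; exact hT _ _ _ _ (hy g hg)
  have hg : g ∈ Subgroup.closure (Set.range (PresentedGroup.of (rels := hwRels))) := by
    rw [PresentedGroup.closure_range_of]; trivial
  suffices h : g ∈ N from h
  induction hg using Subgroup.closure_induction_left with
  | one => exact hw _ (by simp)
  | mul_left a ha b _ hb =>
    obtain ⟨i, rfl⟩ := ha
    fin_cases i
    · exact hx _ hb
    · exact hy _ hb
    · change hwz * b ∈ N
      rw [hwz_eq, mul_assoc]; exact hy' _ (hx' _ hb)
  | inv_mul_cancel a ha b _ hb =>
    obtain ⟨i, rfl⟩ := ha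
    fin_cases i
    · exact hx' _ hb
    · exact hy' _ hb
    · change hwz⁻¹ * b ∈ N
      rw [hwz_eq, mul_inv_rev, inv_inv, inv_inv, mul_assoc]; exact hx _ (hy _ hb)

/-- The realization of the Hantzsche–Wendt group by affine maps. -/
def hwToAffine : HW →* HWAffine :=
  PresentedGroup.toGroup (rels := hwRels) (f := ![⟨1, 1, 0⟩, ⟨0, 1, 1⟩, ⟨1, 0, 1⟩]) (by
    rintro _ (rfl | rfl | rfl) <;> ext <;> simp [pow_two, paritySign])

@[simp] theorem hwToAffine_hwx : hwToAffine hwx = ⟨1, 1, 0⟩ := PresentedGroup.toGroup.of _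
@[simp] theorem hwToAffine_hwy : hwToAffine hwy = ⟨0, 1, 1⟩ := PresentedGroup.toGroup.of _
@[simp] theorem hwToAffine_hwz : hwToAffine hwz = ⟨1, 0, 1⟩ := PresentedGroup.toGroup.of _

theorem hwToAffine_hwx_zpow (i : ℤ) : hwToAffine hwx ^ (2 * i) = ⟨2 * i, 0, 0⟩ := by
  rw [HWAffine.IsScrewA.zpow_two_mul (by simp [HWAffine.IsScrewA])]; simp

theorem hwToAffine_hwy_zpow (i : ℤ) : hwToAffine hwy ^ (2 * i) = ⟨0, 2 * i, 0⟩ := by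
  rw [HWAffine.IsScrewB.zpow_two_mul (by simp [HWAffine.IsScrewB])]; simp

theorem hwToAffine_hwz_zpow (i : ℤ) : hwToAffine hwz ^ (2 * i) = ⟨0, 0, 2 * i⟩ := by
  rw [HWAffine.IsScrewC.zpow_two_mul (by simp [HWAffine.IsScrewC])]; simp

theorem hwToAffine_hwTrans (i j k : ℤ) :
    hwToAffine (hwTrans i j k) = ⟨2 * i, 2 * j, 2 * k⟩ := by
  simp only [hwTrans, map_mul, map_zpow, hwToAffine_hwx_zpow, hwToAffine_hwy_zpow,
    hwToAffine_hwz_zpow]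
  ext <;> simp [paritySign]

theorem hwToAffine_hwTrans_mul (i j k : ℤ) (g : HW) :
    hwToAffine (hwTrans i j k * g) = ⟨2 * i + (hwToAffine g).a, 2 * j + (hwToAffine g).b,
      2 * k + (hwToAffine g).c⟩ := by
  rw [map_mul, hwToAffine_hwTrans, HWAffine.IsTranslation.mul_eq (by simp [HWAffine.IsTranslation])]

theorem hwToAffine_injective : Function.Injective hwToAffine := by
  refine (injective_iff_map_eq_one _).2 fun g hg => ?_
  obtain ⟨i, j, k, w, hw, rfl⟩ := hw_normal_form g
  rw [hwToAffine_hwTrans_mul, HWAffine.ext_iff] at hg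
  rcases hw with rfl | rfl | rfl | rfl <;> simp at hg
  · obtain ⟨rfl, rfl, rfl⟩ := hg
    simp [hwTrans]
  all_goals omega

theorem hwToAffine_types (g : HW) :
    (hwToAffine g).IsTranslation ∨ (hwToAffine g).IsScrewA ∨ (hwToAffine g).IsScrewB ∨
      (hwToAffine g).IsScrewC := by
  obtain ⟨i, j, k, w, hw, rfl⟩ := hw_normal_form g
  rw [hwToAffine_hwTrans_mul]
  rcases hw with rfl | rfl | rfl | rfl <;>
    simp [HWAffine.IsTranslation, HWAffine.IsScrewA, HWAffine.IsScrewB, HWAffine.IsScrewC]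

theorem mem_range_hwToAffine (p : HWAffine) :
    p ∈ hwToAffine.range ↔ (p.a + p.b + p.c) % 2 = 0 := by
  constructor
  · rintro ⟨g, rfl⟩
    rcases hwToAffine_types g with ⟨_, _, _⟩ | ⟨_, _, _⟩ | ⟨_, _, _⟩ | ⟨_, _, _⟩ <;> omega
  · intro h
    have key : ∀ w : HW, p.a % 2 = (hwToAffine w).a % 2 → p.b % 2 = (hwToAffine w).b % 2 →
        p.c % 2 = (hwToAffine w).c % 2 → p ∈ hwToAffine.range := fun w h1 h2 h3 =>
      ⟨hwTrans ((p.a - (hwToAffine w).a) / 2) ((p.b - (hwToAffine w).b) / 2)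
        ((p.c - (hwToAffine w).c) / 2) * w, by
        rw [hwToAffine_hwTrans_mul]; ext <;> dsimp only <;> omega⟩
    rcases Int.emod_two_eq p.a with ha | ha <;> rcases Int.emod_two_eq p.b with hb | hb
    · exact key 1 (by simp [ha]) (by simp [hb]) (by simp; omega)
    · exact key hwy (by simp [ha]) (by simp [hb]) (by simp; omega)
    · exact key hwz (by simp [ha]) (by simp [hb]) (by simp; omega)
    · exact key hwx (by simp [ha]) (by simp [hb]) (by simp; omega)

/-- The affine action on the points of `ℤ³` modulo `(m, k, l)`. -/
abbrev hwPointAction (k l m : ℕ) :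
    MulAction HWAffine (ZMod m × ZMod k × ZMod l) where
  smul p t := (p.a + paritySign p.c * t.1, p.b + paritySign p.a * t.2.1,
    p.c + paritySign p.b * t.2.2)
  one_smul t := by
    change ((((0 : ℤ) : ZMod m) + (paritySign 0 : ℤ) * t.1,
      ((0 : ℤ) : ZMod k) + (paritySign 0 : ℤ) * t.2.1,
      ((0 : ℤ) : ZMod l) + (paritySign 0 : ℤ) * t.2.2) : ZMod m × ZMod k × ZMod l) = t
    simp [paritySign]
  mul_smul p q t := by
    change (((p * q).a + (paritySign (p * q).c : ℤ) * t.1,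
      (p * q).b + (paritySign (p * q).a : ℤ) * t.2.1,
      (p * q).c + (paritySign (p * q).b : ℤ) * t.2.2) : ZMod m × ZMod k × ZMod l) =
      (p.a + (paritySign p.c : ℤ) * (q.a + (paritySign q.c : ℤ) * t.1),
      p.b + (paritySign p.a : ℤ) * (q.b + (paritySign q.a : ℤ) * t.2.1),
      p.c + (paritySign p.b : ℤ) * (q.c + (paritySign q.b : ℤ) * t.2.2))
    simp [paritySign_add]
    refine ⟨?_, ?_, ?_⟩ <;> ring

/-- The stabilizer in the Hantzsche–Wendt group of the point `(s, t, r)` modulo `(m, k, l)`. -/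
def hwStab (k l m : ℕ) (s t r : ℤ) : Subgroup HW :=
  letI := hwPointAction k l m
  (MulAction.stabilizer HWAffine ((s, t, r) : ZMod m × ZMod k × ZMod l)).comap hwToAffine

theorem mem_hwStab {k l m : ℕ} {s t r : ℤ} {g : HW} :
    g ∈ hwStab k l m s t r ↔
      (m : ℤ) ∣ (hwToAffine g).a - 2 * s * ((hwToAffine g).c % 2) ∧
      (k : ℤ) ∣ (hwToAffine g).b - 2 * t * ((hwToAffine g).a % 2) ∧
      (l : ℤ) ∣ (hwToAffine g).c - 2 * r * ((hwToAffine g).b % 2) := by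
  have key : ∀ (m : ℕ) (s a c : ℤ), (a + (paritySign c : ℤ) * s : ZMod m) = s ↔
      (m : ℤ) ∣ a - 2 * s * (c % 2) := by
    intro m s a c
    rw [← ZMod.intCast_zmod_eq_zero_iff_dvd, ← sub_eq_zero]
    simp only [paritySign]
    push_cast
    ring_nf
  change (((hwToAffine g).a + (paritySign (hwToAffine g).c : ℤ) * s,
      (hwToAffine g).b + (paritySign (hwToAffine g).a : ℤ) * t,
      (hwToAffine g).c + (paritySign (hwToAffine g).b : ℤ) * r) : ZMod m × ZMod k × ZMod l) =
      ((s : ZMod m), (t : ZMod k), (r : ZMod l)) ↔ _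
  rw [Prod.mk.injEq, Prod.mk.injEq, key, key, key]

theorem exists_two_mul_eq_zmod {m : ℕ} (hm : Odd m) (d : ZMod m) :
    ∃ i : ℤ, ((2 * i : ℤ) : ZMod m) = d := by
  obtain ⟨q, rfl⟩ := hm
  obtain ⟨d, rfl⟩ := ZMod.intCast_surjective d
  refine ⟨d * (q + 1), ?_⟩
  rw [ZMod.intCast_eq_intCast_iff_dvd_sub]
  exact ⟨-d, by push_cast; ring⟩

theorem hwStab_index {k l m : ℕ} (hk : Odd k) (hl : Odd l) (hm : Odd m) (s t r : ℤ) :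
    (hwStab k l m s t r).index = k * l * m := by
  let := hwPointAction k l m
  let : MulAction HW (ZMod m × ZMod k × ZMod l) := MulAction.compHom _ hwToAffine
  have : MulAction.IsPretransitive HW (ZMod m × ZMod k × ZMod l) := by
    refine ⟨fun p q => ?_⟩
    obtain ⟨i, hi⟩ := exists_two_mul_eq_zmod hm (q.1 - p.1)
    obtain ⟨j, hj⟩ := exists_two_mul_eq_zmod hk (q.2.1 - p.2.1)
    obtain ⟨n, hn⟩ := exists_two_mul_eq_zmod hl (q.2.2 - p.2.2)
    refine ⟨hwTrans i j n, ?_⟩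
    change (((hwToAffine (hwTrans i j n)).a +
      (paritySign (hwToAffine (hwTrans i j n)).c : ℤ) * p.1,
      (hwToAffine (hwTrans i j n)).b +
      (paritySign (hwToAffine (hwTrans i j n)).a : ℤ) * p.2.1,
      (hwToAffine (hwTrans i j n)).c +
      (paritySign (hwToAffine (hwTrans i j n)).b : ℤ) * p.2.2) : ZMod m × ZMod k × ZMod l) = q
    rw [hwToAffine_hwTrans]
    simp only [hi, hj, hn]
    simp [paritySign]
  have h := MulAction.index_stabilizer_of_transitive HW
    ((s, t, r) : ZMod m × ZMod k × ZMod l)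
  change (hwStab k l m s t r).index = _ at h
  rw [h, Nat.card_prod, Nat.card_prod, Nat.card_zmod, Nat.card_zmod, Nat.card_zmod]
  ring

theorem emod_two_eq_of_sub_eq_odd_mul {m a x s y : ℤ} (hm : m % 2 = 1)
    (h : x - 2 * s * y = m * a) : a % 2 = x % 2 := by
  have : x = m * a + 2 * (s * y) := by linarith
  rw [this]; simp [Int.add_emod, Int.mul_emod, hm]

theorem natCast_emod_two_of_odd {m : ℕ} (hm : Odd m) : (m : ℤ) % 2 = 1 := by
  have := Nat.odd_iff.1 hm
  omega

theorem nonempty_hwStab_mulEquiv {k l m : ℕ} (hk : Odd k) (hl : Odd l) (hm : Odd m)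
    (s t r : ℤ) : Nonempty (hwStab k l m s t r ≃* HW) := by
  have hm' := natCast_emod_two_of_odd hm
  have hk' := natCast_emod_two_of_odd hk
  have hl' := natCast_emod_two_of_odd hl
  let S := HWAffine.scale hm' hk' hl' s t r
  have hmap : (hwStab k l m s t r).map hwToAffine = hwToAffine.range.map S := by
    ext p
    constructor
    · rintro ⟨g, hg, rfl⟩
      have hsum := (mem_range_hwToAffine _).1 ⟨g, rfl⟩
      obtain ⟨⟨a, ha⟩, ⟨b, hb⟩, ⟨c, hc⟩⟩ := mem_hwStab.1 hg
      have ha2 := emod_two_eq_of_sub_eq_odd_mul hm' ha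
      have hb2 := emod_two_eq_of_sub_eq_odd_mul hk' hb
      have hc2 := emod_two_eq_of_sub_eq_odd_mul hl' hc
      refine ⟨⟨a, b, c⟩, (mem_range_hwToAffine _).2 (by dsimp only; omega), ?_⟩
      change (⟨m * a + 2 * s * (c % 2), k * b + 2 * t * (a % 2), l * c + 2 * r * (b % 2)⟩ :
        HWAffine) = _
      ext <;> simp only [ha2, hb2, hc2] <;> linarith
    · rintro ⟨p, hp, rfl⟩
      have hp' := (mem_range_hwToAffine _).1 hp
      have ha2 := emod_two_eq_of_sub_eq_odd_mul (s := s) (y := p.c % 2) hm'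
        (add_sub_cancel_right (m * p.a) _)
      have hb2 := emod_two_eq_of_sub_eq_odd_mul (s := t) (y := p.a % 2) hk'
        (add_sub_cancel_right (k * p.b) _)
      have hc2 := emod_two_eq_of_sub_eq_odd_mul (s := r) (y := p.b % 2) hl'
        (add_sub_cancel_right (l * p.c) _)
      obtain ⟨g, hg⟩ : S p ∈ hwToAffine.range := (mem_range_hwToAffine _).2 <| by
        change (m * p.a + 2 * s * (p.c % 2) + (k * p.b + 2 * t * (p.a % 2)) +
          (l * p.c + 2 * r * (p.b % 2))) % 2 = 0
        omega
      refine ⟨g, mem_hwStab.2 ?_, hg⟩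
      rw [hg]
      change (m : ℤ) ∣ (m * p.a + 2 * s * (p.c % 2)) -
          2 * s * ((l * p.c + 2 * r * (p.b % 2)) % 2) ∧
        (k : ℤ) ∣ (k * p.b + 2 * t * (p.a % 2)) -
          2 * t * ((m * p.a + 2 * s * (p.c % 2)) % 2) ∧
        (l : ℤ) ∣ (l * p.c + 2 * r * (p.b % 2)) -
          2 * r * ((k * p.b + 2 * t * (p.a % 2)) % 2)
      rw [← ha2, ← hb2, ← hc2]
      simp
  let e1 := (hwStab k l m s t r).equivMapOfInjective _ hwToAffine_injective
  let e2 := hwToAffine.range.equivMapOfInjective S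
    (HWAffine.scale_injective hm' hk' hl' s t r)
  let e3 := MonoidHom.ofInjective hwToAffine_injective
  exact ⟨e1.trans ((MulEquiv.subgroupCongr hmap).trans (e2.symm.trans e3.symm))⟩

theorem hw_subgroup_le_of_translations {H K : Subgroup HW} {P Q R : HW}
    (hPA : (hwToAffine P).IsScrewA) (hQB : (hwToAffine Q).IsScrewB)
    (hRC : (hwToAffine R).IsScrewC) (hP : P ∈ H) (hQ : Q ∈ H) (hR : R ∈ H)
    (hP' : P ∈ K) (hQ' : Q ∈ K) (hR' : R ∈ K)
    (h : ∀ g ∈ H, (hwToAffine g).IsTranslation → g ∈ K) : H ≤ K := by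
  have key : ∀ g ∈ H, ∀ w ∈ H, w ∈ K → (hwToAffine g).a % 2 = (hwToAffine w).a % 2 →
      (hwToAffine g).b % 2 = (hwToAffine w).b % 2 →
      (hwToAffine g).c % 2 = (hwToAffine w).c % 2 → g ∈ K := by
    intro g hg w hw hw' h1 h2 h3
    refine (Subgroup.mul_mem_cancel_right K (inv_mem hw')).1
      (h _ (mul_mem hg (inv_mem hw)) ?_)
    have i1 := HWAffine.inv_a_emod_two (hwToAffine w)
    have i2 := HWAffine.inv_b_emod_two (hwToAffine w)
    have i3 := HWAffine.inv_c_emod_two (hwToAffine w)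
    rw [map_mul, map_inv]
    refine ⟨?_, ?_, ?_⟩
    · rw [HWAffine.mul_a_emod_two]; omega
    · rw [HWAffine.mul_b_emod_two]; omega
    · rw [HWAffine.mul_c_emod_two]; omega
  intro g hg
  obtain ⟨a1, a2, a3⟩ := hPA
  obtain ⟨b1, b2, b3⟩ := hQB
  obtain ⟨c1, c2, c3⟩ := hRC
  rcases hwToAffine_types g with hT | ⟨h1, h2, h3⟩ | ⟨h1, h2, h3⟩ | ⟨h1, h2, h3⟩
  · exact h g hg hT
  · exact key g hg P hP hP' (by omega) (by omega) (by omega)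
  · exact key g hg Q hQ hQ' (by omega) (by omega) (by omega)
  · exact key g hg R hR hR' (by omega) (by omega) (by omega)

theorem exists_eq_two_mul_mul_of_dvd {m : ℕ} {p a : ℤ} (hpm : p.natAbs = m) (hp : p % 2 = 1)
    (ha : a % 2 = 0) (h : (m : ℤ) ∣ a) : ∃ i : ℤ, a = 2 * (i * p) := by
  have h' : p ∣ a := by rwa [← hpm, Int.natAbs_dvd] at h
  obtain ⟨q, rfl⟩ := h'
  have hq : q % 2 = 0 := by
    rcases Int.emod_two_eq q with h | h
    · exact h
    · simp [Int.mul_emod, hp, h] at ha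
  exact ⟨q / 2, by rw [← mul_assoc, Int.mul_ediv_cancel' (Int.dvd_of_emod_eq_zero hq), mul_comm]⟩

theorem hwStab_le_closure {k l m : ℕ} {s t r : ℤ} {P Q R : HW}
    (hPA : (hwToAffine P).IsScrewA) (hQB : (hwToAffine Q).IsScrewB)
    (hRC : (hwToAffine R).IsScrewC) (hP : P ∈ hwStab k l m s t r)
    (hQ : Q ∈ hwStab k l m s t r) (hR : R ∈ hwStab k l m s t r)
    (hm : (hwToAffine P).a.natAbs = m) (hk : (hwToAffine Q).b.natAbs = k)
    (hl : (hwToAffine R).c.natAbs = l) :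
    hwStab k l m s t r ≤ Subgroup.closure {P, Q, R} := by
  have hP' : P ∈ Subgroup.closure {P, Q, R} := Subgroup.subset_closure (by simp)
  have hQ' : Q ∈ Subgroup.closure {P, Q, R} := Subgroup.subset_closure (by simp)
  have hR' : R ∈ Subgroup.closure {P, Q, R} := Subgroup.subset_closure (by simp)
  refine hw_subgroup_le_of_translations hPA hQB hRC hP hQ hR hP' hQ' hR' fun g hg ⟨h1, h2, h3⟩ => ?_
  obtain ⟨da, db, dc⟩ := mem_hwStab.1 hg
  rw [h3, mul_zero, sub_zero] at da
  rw [h1, mul_zero, sub_zero] at db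
  rw [h2, mul_zero, sub_zero] at dc
  obtain ⟨i, hi⟩ := exists_eq_two_mul_mul_of_dvd hm hPA.1 h1 da
  obtain ⟨j, hj⟩ := exists_eq_two_mul_mul_of_dvd hk hQB.2.1 h2 db
  obtain ⟨n, hn⟩ := exists_eq_two_mul_mul_of_dvd hl hRC.2.2 h3 dc
  have : g = P ^ (2 * i) * Q ^ (2 * j) * R ^ (2 * n) := by
    apply hwToAffine_injective
    rw [map_mul, map_mul, map_zpow, map_zpow, map_zpow, hPA.zpow_two_mul, hQB.zpow_two_mul,
      hRC.zpow_two_mul]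
    ext <;> simp [paritySign, hi, hj, hn]
  rw [this]
  exact mul_mem (mul_mem (zpow_mem hP' _) (zpow_mem hQ' _)) (zpow_mem hR' _)

theorem hwStab_congr {k l m : ℕ} {s t r s' t' r' : ℤ} (hs : (s : ZMod m) = s')
    (ht : (t : ZMod k) = t') (hr : (r : ZMod l) = r') :
    hwStab k l m s t r = hwStab k l m s' t' r' := by
  unfold hwStab; rw [hs, ht, hr]

/-- The generator `X = x^m y^{[1-k+2w]_{2k}} z^{[ℓ-1+2u]_{2ℓ}}`. -/
def hwGenX (k l m u w : ℕ) : HW :=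
  hwx ^ (m : ℤ) * hwy ^ ((1 - (k : ℤ) + 2 * w) % (2 * k)) *
    hwz ^ (((l : ℤ) - 1 + 2 * u) % (2 * l))

/-- The generator `Y = y^k x^{[m-1+2v]_{2m}} z^{2u}`. -/
def hwGenY (k m u v : ℕ) : HW :=
  hwy ^ (k : ℤ) * hwx ^ (((m : ℤ) - 1 + 2 * v) % (2 * m)) * hwz ^ (2 * (u : ℤ))

/-- The generator `Z = z^ℓ x^{2v} y^{2w}`. -/
def hwGenZ (l v w : ℕ) : HW :=
  hwz ^ (l : ℤ) * hwx ^ (2 * (v : ℤ)) * hwy ^ (2 * (w : ℤ))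

theorem hwSub_eq_closure (k l m u v w : ℕ) : hwSub (k, l, m, u, v, w) =
    Subgroup.closure {hwGenX k l m u w, hwGenY k m u v, hwGenZ l v w} := rfl

theorem exists_emod_two_mul_eq {k : ℕ} {c : ℤ} (hc : c % 2 = 0) :
    ∃ i q : ℤ, c % (2 * k) = 2 * i ∧ 2 * i = c - 2 * (k * q) := by
  have h : c % (2 * k) = c - 2 * (k * (c / (2 * k))) := by
    rw [Int.emod_def, mul_assoc]
  refine ⟨c / 2 - k * (c / (2 * k)), c / (2 * k), ?_, ?_⟩
  · rw [h]; omega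
  · omega

theorem hwToAffine_odd_zpow {n : ℕ} (hn : Odd n) :
    hwToAffine hwx ^ (n : ℤ) = ⟨n, 1, 0⟩ ∧ hwToAffine hwy ^ (n : ℤ) = ⟨0, n, 1⟩ ∧
      hwToAffine hwz ^ (n : ℤ) = ⟨1, 0, n⟩ := by
  obtain ⟨q, rfl⟩ := hn
  push_cast
  refine ⟨?_, ?_, ?_⟩
  · rw [zpow_add_one, hwToAffine_hwx_zpow]; ext <;> simp [paritySign]
  · rw [zpow_add_one, hwToAffine_hwy_zpow]; ext <;> simp [paritySign]
  · rw [zpow_add_one, hwToAffine_hwz_zpow]; ext <;> simp [paritySign]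

theorem hwToAffine_hwGenX {k l m : ℕ} (u w : ℕ) (hk : Odd k) (hl : Odd l) (hm : Odd m) :
    ∃ p q : ℤ, hwToAffine (hwGenX k l m u w) =
      ⟨m, k - 2 * w + 2 * (k * p), 1 - l - 2 * u + 2 * (l * q)⟩ := by
  have hk' := natCast_emod_two_of_odd hk
  have hl' := natCast_emod_two_of_odd hl
  obtain ⟨i, p, hi, hi'⟩ := exists_emod_two_mul_eq (k := k) (c := 1 - (k : ℤ) + 2 * w) (by omega)
  obtain ⟨j, q, hj, hj'⟩ := exists_emod_two_mul_eq (k := l) (c := (l : ℤ) - 1 + 2 * u) (by omega)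
  refine ⟨p, q, ?_⟩
  rw [hwGenX, hi, hj, map_mul, map_mul, map_zpow, map_zpow, map_zpow, (hwToAffine_odd_zpow hm).1,
    hwToAffine_hwy_zpow, hwToAffine_hwz_zpow]
  have h1 : paritySign m = -1 := by
    have := natCast_emod_two_of_odd hm
    simp [paritySign, this]
  have h2 : paritySign (1 + -(2 * i)) = -1 := by
    have : (1 + -(2 * i)) % 2 = 1 := by omega
    simp [paritySign, this]
  ext <;> simp [h1, h2] <;> linarith

theorem hwToAffine_hwGenY {k m : ℕ} (u v : ℕ) (hk : Odd k) (hm : Odd m) :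
    ∃ p : ℤ, hwToAffine (hwGenY k m u v) =
      ⟨1 - m - 2 * v + 2 * (m * p), k, 1 - 2 * u⟩ := by
  have hm' := natCast_emod_two_of_odd hm
  obtain ⟨i, p, hi, hi'⟩ := exists_emod_two_mul_eq (k := m) (c := (m : ℤ) - 1 + 2 * v) (by omega)
  refine ⟨p, ?_⟩
  rw [hwGenY, hi, map_mul, map_mul, map_zpow, map_zpow, map_zpow, (hwToAffine_odd_zpow hk).2.1,
    hwToAffine_hwx_zpow, hwToAffine_hwz_zpow]
  have h1 : paritySign k = -1 := by
    have := natCast_emod_two_of_odd hk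
    simp [paritySign, this]
  have h2 : paritySign 1 = -1 := rfl
  ext <;> simp [h1, h2] <;> linarith

theorem hwToAffine_hwGenZ {l : ℕ} (v w : ℕ) (hl : Odd l) :
    hwToAffine (hwGenZ l v w) = ⟨1 - 2 * v, -2 * w, l⟩ := by
  rw [hwGenZ, map_mul, map_mul, map_zpow, map_zpow, map_zpow, (hwToAffine_odd_zpow hl).2.2,
    hwToAffine_hwx_zpow, hwToAffine_hwy_zpow]
  have h1 : paritySign l = -1 := by
    have := natCast_emod_two_of_odd hl
    simp [paritySign, this]
  have h2 : paritySign (1 + -(2 * v)) = -1 := by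
    have : (1 + -(2 * v) : ℤ) % 2 = 1 := by omega
    simp [paritySign, this]
  ext <;> simp [h1, h2] ; linarith

theorem hwSub_eq_hwStab {k l m : ℕ} (u v w : ℕ) (hk : Odd k) (hl : Odd l) (hm : Odd m) :
    hwSub (k, l, m, u, v, w) =
      hwStab k l m ((1 - m) / 2 - v) (-w) ((1 - l) / 2 - u) := by
  have hk' := natCast_emod_two_of_odd hk
  have hl' := natCast_emod_two_of_odd hl
  have hm' := natCast_emod_two_of_odd hm
  have em : 2 * ((1 - (m : ℤ)) / 2 - v) = 1 - m - 2 * v := by omega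
  have el : 2 * ((1 - (l : ℤ)) / 2 - u) = 1 - l - 2 * u := by omega
  obtain ⟨p, q, hX⟩ := hwToAffine_hwGenX u w hk hl hm
  obtain ⟨p', hY⟩ := hwToAffine_hwGenY u v hk hm
  have hZ := hwToAffine_hwGenZ v w hl
  have tX : (hwToAffine (hwGenX k l m u w)).IsScrewA := by
    rw [hX]; refine ⟨?_, ?_, ?_⟩ <;> dsimp only <;> omega
  have tY : (hwToAffine (hwGenY k m u v)).IsScrewB := by
    rw [hY]; refine ⟨?_, ?_, ?_⟩ <;> dsimp only <;> omega
  have tZ : (hwToAffine (hwGenZ l v w)).IsScrewC := by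
    rw [hZ]; refine ⟨?_, ?_, ?_⟩ <;> dsimp only <;> omega
  have mX : hwGenX k l m u w ∈ hwStab k l m ((1 - m) / 2 - v) (-w) ((1 - l) / 2 - u) := by
    rw [mem_hwStab, tX.1, tX.2.1, tX.2.2, em, el, hX]
    exact ⟨⟨1, by ring⟩, ⟨1 + 2 * p, by ring⟩, ⟨2 * q, by ring⟩⟩
  have mY : hwGenY k m u v ∈ hwStab k l m ((1 - m) / 2 - v) (-w) ((1 - l) / 2 - u) := by
    rw [mem_hwStab, tY.1, tY.2.1, tY.2.2, em, el, hY]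
    exact ⟨⟨2 * p', by ring⟩, ⟨1, by ring⟩, ⟨1, by ring⟩⟩
  have mZ : hwGenZ l v w ∈ hwStab k l m ((1 - m) / 2 - v) (-w) ((1 - l) / 2 - u) := by
    rw [mem_hwStab, tZ.1, tZ.2.1, tZ.2.2, em, el, hZ]
    exact ⟨⟨1, by ring⟩, ⟨0, by ring⟩, ⟨1, by ring⟩⟩
  rw [hwSub_eq_closure]
  refine le_antisymm ?_ (hwStab_le_closure tX tY tZ mX mY mZ ?_ ?_ ?_)
  · rw [Subgroup.closure_le]
    rintro _ (rfl | rfl | rfl) <;> assumption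
  · simp [hX]
  · simp [hY]
  · simp [hZ]

theorem exists_lt_intCast_sub_eq {m : ℕ} (hm : 0 < m) (c s : ℤ) :
    ∃ v < m, ((c - (v : ℤ) : ℤ) : ZMod m) = s := by
  have hm' : (0 : ℤ) < m := by exact_mod_cast hm
  have h1 := Int.emod_nonneg (c - s) hm'.ne'
  have h2 := Int.emod_lt_of_pos (c - s) hm'
  refine ⟨((c - s) % m).toNat, by omega, ?_⟩
  rw [Int.toNat_of_nonneg h1, Int.cast_sub, ZMod.intCast_mod]
  simp

theorem exists_hwSub_eq_hwStab {k l m : ℕ} (hk : Odd k) (hl : Odd l) (hm : Odd m) (s t r : ℤ) :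
    ∃ u v w : ℕ, v < m ∧ u < l ∧ w < k ∧
      hwSub (k, l, m, u, v, w) = hwStab k l m s t r := by
  obtain ⟨v, hv, hv'⟩ := exists_lt_intCast_sub_eq hm.pos ((1 - m) / 2) s
  obtain ⟨u, hu, hu'⟩ := exists_lt_intCast_sub_eq hl.pos ((1 - l) / 2) r
  obtain ⟨w, hw, hw'⟩ := exists_lt_intCast_sub_eq hk.pos 0 t
  rw [zero_sub] at hw'
  exact ⟨u, v, w, hv, hu, hw, by rw [hwSub_eq_hwStab u v w hk hl hm, hwStab_congr hv' hw' hu']⟩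

theorem hwTrans_mem_hwStab {k l m : ℕ} {s t r i j n : ℤ} :
    hwTrans i j n ∈ hwStab k l m s t r ↔ (m : ℤ) ∣ 2 * i ∧ (k : ℤ) ∣ 2 * j ∧ (l : ℤ) ∣ 2 * n := by
  rw [mem_hwStab, hwToAffine_hwTrans]; simp

theorem dvd_of_odd_of_dvd_two_mul {m : ℕ} (hm : Odd m) {d : ℤ} (h : (m : ℤ) ∣ 2 * d) :
    (m : ℤ) ∣ d := by
  refine IsCoprime.dvd_of_dvd_mul_left ?_ h
  rw [← Nat.cast_ofNat, Nat.isCoprime_iff_coprime]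
  exact Nat.coprime_two_right.2 hm

theorem dvd_of_hwStab_eq {k l m k' l' m' : ℕ} {s t r s' t' r' : ℤ} (hk : Odd k) (hl : Odd l)
    (hm : Odd m) (h : hwStab k l m s t r = hwStab k' l' m' s' t' r') :
    k ∣ k' ∧ l ∣ l' ∧ m ∣ m' := by
  have h1 : hwTrans m' k' l' ∈ hwStab k l m s t r := by rw [h]; simp [hwTrans_mem_hwStab]
  obtain ⟨ha, hb, hc⟩ := hwTrans_mem_hwStab.1 h1
  exact ⟨by exact_mod_cast dvd_of_odd_of_dvd_two_mul hk hb,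
    by exact_mod_cast dvd_of_odd_of_dvd_two_mul hl hc,
    by exact_mod_cast dvd_of_odd_of_dvd_two_mul hm ha⟩

theorem eq_of_odd_of_dvd_two_mul_sub {m a b : ℕ} (hm : Odd m) (ha : a < m) (hb : b < m)
    (h : (m : ℤ) ∣ 2 * ((a : ℤ) - b)) : a = b := by
  have := Int.eq_zero_of_abs_lt_dvd (dvd_of_odd_of_dvd_two_mul hm h) (by rw [abs_lt]; omega)
  omega

theorem hwSub_injOn {k l m u v w k' l' m' u' v' w' : ℕ} (hk : Odd k) (hl : Odd l) (hm : Odd m)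
    (hk' : Odd k') (hl' : Odd l') (hm' : Odd m') (hv : v < m) (hu : u < l) (hw : w < k)
    (hv' : v' < m') (hu' : u' < l') (hw' : w' < k')
    (h : hwSub (k, l, m, u, v, w) = hwSub (k', l', m', u', v', w')) :
    (k, l, m, u, v, w) = (k', l', m', u', v', w') := by
  have hs := h
  rw [hwSub_eq_hwStab _ _ _ hk hl hm, hwSub_eq_hwStab _ _ _ hk' hl' hm'] at hs
  obtain ⟨d1, d2, d3⟩ := dvd_of_hwStab_eq hk hl hm hs
  obtain ⟨d1', d2', d3'⟩ := dvd_of_hwStab_eq hk' hl' hm' hs.symm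
  obtain rfl := Nat.dvd_antisymm d1 d1'
  obtain rfl := Nat.dvd_antisymm d2 d2'
  obtain rfl := Nat.dvd_antisymm d3 d3'
  have el := natCast_emod_two_of_odd hl
  have em := natCast_emod_two_of_odd hm
  have hY : hwGenY k m u' v' ∈ hwSub (k, l, m, u, v, w) := by
    rw [h]; exact Subgroup.subset_closure (Or.inr (Or.inl rfl))
  have hZ : hwGenZ l v' w' ∈ hwSub (k, l, m, u, v, w) := by
    rw [h]; exact Subgroup.subset_closure (Or.inr (Or.inr rfl))
  rw [hwSub_eq_hwStab _ _ _ hk hl hm, mem_hwStab] at hY hZ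
  obtain ⟨p', hY'⟩ := hwToAffine_hwGenY u' v' hk hm
  rw [hY'] at hY
  rw [hwToAffine_hwGenZ _ _ hl] at hZ
  obtain ⟨-, -, hc⟩ := hY
  obtain ⟨ha, hb, -⟩ := hZ
  dsimp only at ha hb hc
  rw [natCast_emod_two_of_odd hk, show 2 * ((1 - (l : ℤ)) / 2 - u) = 1 - l - 2 * u by omega] at hc
  rw [el, show 2 * ((1 - (m : ℤ)) / 2 - v) = 1 - m - 2 * v by omega] at ha
  rw [show (1 - 2 * (v' : ℤ)) % 2 = 1 by omega] at hb
  have e1 : u = u' := eq_of_odd_of_dvd_two_mul_sub hl hu hu' (by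
    obtain ⟨q, hq⟩ := hc
    exact ⟨q - 1, by linear_combination hq⟩)
  have e2 : v = v' := eq_of_odd_of_dvd_two_mul_sub hm hv hv' (by
    obtain ⟨q, hq⟩ := ha
    exact ⟨q - 1, by linear_combination hq⟩)
  have e3 : w = w' := eq_of_odd_of_dvd_two_mul_sub hk hw hw' (by
    convert hb using 1; ring)
  rw [e1, e2, e3]

theorem eq_hwStab_of_screws {H : Subgroup HW} {P Q R : HW}
    (hPA : (hwToAffine P).IsScrewA) (hQB : (hwToAffine Q).IsScrewB)
    (hRC : (hwToAffine R).IsScrewC) (hP : P ∈ H) (hQ : Q ∈ H) (hR : R ∈ H)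
    (hT : ∀ g ∈ H, (hwToAffine g).IsTranslation → (hwToAffine P).a ∣ (hwToAffine g).a ∧
      (hwToAffine Q).b ∣ (hwToAffine g).b ∧ (hwToAffine R).c ∣ (hwToAffine g).c) :
    ∃ k l m : ℕ, Odd k ∧ Odd l ∧ Odd m ∧ ∃ s t r : ℤ, H = hwStab k l m s t r := by
  obtain ⟨a1, a2, a3⟩ := id hPA
  obtain ⟨b1, b2, b3⟩ := id hQB
  obtain ⟨c1, c2, c3⟩ := id hRC
  have half : ∀ p x : ℤ, p % 2 = 1 → ∃ s, p ∣ x - 2 * s := fun p x hp =>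
    ⟨x * ((p + 1) / 2), -x, by
      have : 2 * ((p + 1) / 2) = p + 1 := by omega
      linear_combination (-x) * this⟩
  obtain ⟨s, hs⟩ := half (hwToAffine P).a (hwToAffine R).a a1
  obtain ⟨t, ht⟩ := half (hwToAffine Q).b (hwToAffine R).b b2
  obtain ⟨r, hr⟩ := half (hwToAffine R).c (hwToAffine Q).c c3
  have hmul : hwToAffine (P * Q * R) = ⟨(hwToAffine P).a + (hwToAffine Q).a - (hwToAffine R).a,
      (hwToAffine P).b - (hwToAffine Q).b - (hwToAffine R).b,
      (hwToAffine P).c - (hwToAffine Q).c + (hwToAffine R).c⟩ := by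
    have e1 : paritySign (hwToAffine P).c = 1 := by simp [paritySign, a3]
    have e2 : paritySign (hwToAffine P).a = -1 := by simp [paritySign, a1]
    have e3 : paritySign (hwToAffine P).b = -1 := by simp [paritySign, a2]
    have e4 : paritySign (hwToAffine Q).a = 1 := by simp [paritySign, b1]
    have e5 : paritySign (hwToAffine Q).b = -1 := by simp [paritySign, b2]
    have e6 : paritySign (hwToAffine Q).c = -1 := by simp [paritySign, b3]
    ext <;> simp only [map_mul, HWAffine.mul_a, HWAffine.mul_b, HWAffine.mul_c, paritySign_add,
      paritySign_neg, neg_mul, one_mul, e1, e2, e3, e4, e5, e6] <;> ring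
  have hPQR := hT (P * Q * R) (mul_mem (mul_mem hP hQ) hR) (by
    rw [hmul]; refine ⟨?_, ?_, ?_⟩ <;> dsimp only <;> omega)
  rw [hmul] at hPQR
  obtain ⟨⟨x, hx⟩, ⟨y, hy⟩, ⟨z, hz⟩⟩ := hPQR
  obtain ⟨s', hs'⟩ := id hs
  obtain ⟨t', ht'⟩ := id ht
  obtain ⟨r', hr'⟩ := id hr
  dsimp only at hx hy hz
  refine ⟨(hwToAffine Q).b.natAbs, (hwToAffine R).c.natAbs, (hwToAffine P).a.natAbs,
    Int.natAbs_odd.2 (Int.odd_iff.2 b2), Int.natAbs_odd.2 (Int.odd_iff.2 c3),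
    Int.natAbs_odd.2 (Int.odd_iff.2 a1), s, t, r, ?_⟩
  have mP : P ∈ hwStab (hwToAffine Q).b.natAbs (hwToAffine R).c.natAbs
      (hwToAffine P).a.natAbs s t r := by
    rw [mem_hwStab, Int.natAbs_dvd, Int.natAbs_dvd, Int.natAbs_dvd, a1, a2, a3]
    exact ⟨⟨1, by ring⟩, ⟨y + t' + 1, by linear_combination hy + ht'⟩,
      ⟨z + r' - 1, by linear_combination hz + hr'⟩⟩
  have mQ : Q ∈ hwStab (hwToAffine Q).b.natAbs (hwToAffine R).c.natAbs
      (hwToAffine P).a.natAbs s t r := by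
    rw [mem_hwStab, Int.natAbs_dvd, Int.natAbs_dvd, Int.natAbs_dvd, b1, b2, b3]
    exact ⟨⟨x + s' - 1, by linear_combination hx + hs'⟩, ⟨1, by ring⟩, by simpa using hr⟩
  have mR : R ∈ hwStab (hwToAffine Q).b.natAbs (hwToAffine R).c.natAbs
      (hwToAffine P).a.natAbs s t r := by
    rw [mem_hwStab, Int.natAbs_dvd, Int.natAbs_dvd, Int.natAbs_dvd, c1, c2, c3]
    exact ⟨by simpa using hs, by simpa using ht, ⟨1, by ring⟩⟩
  refine le_antisymm (hw_subgroup_le_of_translations hPA hQB hRC hP hQ hR mP mQ mR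
    fun g hg hgT => ?_) ((hwStab_le_closure hPA hQB hRC mP mQ mR rfl rfl rfl).trans ?_)
  · rw [mem_hwStab, Int.natAbs_dvd, Int.natAbs_dvd, Int.natAbs_dvd]
    obtain ⟨h1, h2, h3⟩ := id hgT
    rw [h1, h2, h3]
    simpa using hT g hg hgT
  · rw [Subgroup.closure_le]
    rintro _ (rfl | rfl | rfl) <;> assumption

theorem hwToAffine_pow_two_isTranslation (g : HW) : (hwToAffine (g ^ 2)).IsTranslation := by
  rw [pow_two, map_mul]
  refine ⟨?_, ?_, ?_⟩
  · rw [HWAffine.mul_a_emod_two]; omega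
  · rw [HWAffine.mul_b_emod_two]; omega
  · rw [HWAffine.mul_c_emod_two]; omega

theorem not_isTranslation_of_not_commute {f : HW →* HW} (hf : Function.Injective f) {g h : HW}
    (hgh : g * h ^ 2 ≠ h ^ 2 * g) : ¬ (hwToAffine (f g)).IsTranslation := fun hT => by
  have := hT.mul_comm (hwToAffine_pow_two_isTranslation (f h))
  rw [← map_mul, ← map_mul, ← map_pow, ← map_mul, ← map_mul] at this
  exact hgh (hf (hwToAffine_injective this))

theorem hwToAffine_map_translation_of_isTranslation {f : HW →* HW}
    (hx : ¬ (hwToAffine (f hwx)).IsTranslation) (hy : ¬ (hwToAffine (f hwy)).IsTranslation)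
    (hz : ¬ (hwToAffine (f hwz)).IsTranslation) (g : HW) (hg : (hwToAffine (f g)).IsTranslation) :
    ∃ i j k : ℤ, hwToAffine (f g) = hwToAffine (f hwx) ^ (2 * i) * hwToAffine (f hwy) ^ (2 * j) *
      hwToAffine (f hwz) ^ (2 * k) := by
  have sq : ∀ g (n : ℤ), (hwToAffine g ^ (2 * n)).IsTranslation := fun g n => by
    have := hwToAffine_pow_two_isTranslation (g ^ n)
    rwa [← zpow_natCast, ← zpow_mul, map_zpow, mul_comm n] at this
  obtain ⟨i, j, k, w, hw, rfl⟩ := hw_normal_form g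
  simp only [hwTrans, map_mul, map_zpow] at hg ⊢
  have hw' := (((sq (f hwx) i).mul (sq (f hwy) j)).mul (sq (f hwz) k)).of_mul hg
  refine ⟨i, j, k, ?_⟩
  rcases hw with rfl | rfl | rfl | rfl
  · simp
  all_goals contradiction

theorem range_eq_hwStab {f : HW →* HW} (hf : Function.Injective f) :
    ∃ k l m : ℕ, Odd k ∧ Odd l ∧ Odd m ∧ ∃ s t r : ℤ, f.range = hwStab k l m s t r := by
  have comm : ∀ {g h : HW}, hwToAffine (g * h ^ 2) ≠ hwToAffine (h ^ 2 * g) →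
      ¬ (hwToAffine (f g)).IsTranslation := fun h =>
    not_isTranslation_of_not_commute hf fun h' => h (congrArg _ h')
  have hx : ¬ (hwToAffine (f hwx)).IsTranslation :=
    comm (h := hwy) (by simp [HWAffine.ext_iff, pow_two, paritySign])
  have hy : ¬ (hwToAffine (f hwy)).IsTranslation :=
    comm (h := hwx) (by simp [HWAffine.ext_iff, pow_two, paritySign])
  have hz : ¬ (hwToAffine (f hwz)).IsTranslation :=
    comm (h := hwx) (by simp [HWAffine.ext_iff, pow_two, paritySign])
  have key := hwToAffine_map_translation_of_isTranslation hx hy hz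
  have hprod : hwToAffine (f hwx) * hwToAffine (f hwy) * hwToAffine (f hwz) = 1 := by
    rw [← map_mul, ← map_mul, ← map_mul, ← map_mul, hwx_mul_hwy_mul_hwz, map_one, map_one]
  have hpa := HWAffine.mul_a_emod_two (hwToAffine (f hwx) * hwToAffine (f hwy)) (hwToAffine (f hwz))
  have hpb := HWAffine.mul_b_emod_two (hwToAffine (f hwx) * hwToAffine (f hwy)) (hwToAffine (f hwz))
  have hpa' := HWAffine.mul_a_emod_two (hwToAffine (f hwx)) (hwToAffine (f hwy))
  have hpb' := HWAffine.mul_b_emod_two (hwToAffine (f hwx)) (hwToAffine (f hwy))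
  rw [hprod] at hpa hpb
  simp only [HWAffine.one_a, HWAffine.one_b] at hpa hpb
  rcases (hwToAffine_types (f hwx)).resolve_left hx with tx | tx | tx <;>
  rcases (hwToAffine_types (f hwy)).resolve_left hy with ty | ty | ty <;>
  rcases (hwToAffine_types (f hwz)).resolve_left hz with tz | tz | tz <;>
  first
  | (exfalso
     have x1 := tx.1
     have x2 := tx.2.1
     have y1 := ty.1
     have y2 := ty.2.1
     have z1 := tz.1
     have z2 := tz.2.1
     omega)
  | (refine eq_hwStab_of_screws ‹(hwToAffine _).IsScrewA› ‹(hwToAffine _).IsScrewB›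
       ‹(hwToAffine _).IsScrewC› ⟨_, rfl⟩ ⟨_, rfl⟩ ⟨_, rfl⟩ ?_
     rintro _ ⟨g, rfl⟩ hg
     obtain ⟨i, j, k, h⟩ := key g hg
     rw [h, tx.zpow_two_mul, ty.zpow_two_mul, tz.zpow_two_mul]
     simp [paritySign, ← mul_assoc])

theorem stmt13 (n : ℕ) (hn : 0 < n) :
    Function.Injective (fun t : {t // hwCond n t} => hwSub t.1) ∧
      Set.range (fun t : {t // hwCond n t} => hwSub t.1) =
        {H : Subgroup HW | H.index = n ∧ Nonempty (H ≃* HW)} := by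
  constructor
  · rintro ⟨⟨k, l, m, u, v, w⟩, hk, hl, hm, _, _, _, _, hv, hu, hw⟩
      ⟨⟨k', l', m', u', v', w'⟩, hk', hl', hm', _, _, _, _, hv', hu', hw'⟩ h
    exact Subtype.ext (hwSub_injOn hk hl hm hk' hl' hm' hv hu hw hv' hu' hw' h)
  · ext H
    constructor
    · rintro ⟨⟨⟨k, l, m, u, v, w⟩, hk, hl, hm, _, _, _, hn', _, _, _⟩, rfl⟩
      dsimp only
      rw [hwSub_eq_hwStab u v w hk hl hm]
      exact ⟨by rw [hwStab_index hk hl hm, hn'], nonempty_hwStab_mulEquiv hk hl hm _ _ _⟩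
    · rintro ⟨hH, ⟨e⟩⟩
      have hf : Function.Injective (H.subtype.comp e.symm.toMonoidHom) :=
        H.subtype_injective.comp e.symm.injective
      obtain ⟨k, l, m, hk, hl, hm, s, t, r, h⟩ := range_eq_hwStab hf
      have hr : (H.subtype.comp e.symm.toMonoidHom).range = H := by
        rw [MonoidHom.range_comp, MonoidHom.range_eq_top.2 e.symm.surjective,
          ← MonoidHom.range_eq_map, H.range_subtype]
      rw [hr] at h
      obtain ⟨u, v, w, hv, hu, hw, h'⟩ := exists_hwSub_eq_hwStab hk hl hm s t r
      refine ⟨⟨(k, l, m, u, v, w), hk, hl, hm, hk.pos, hl.pos, hm.pos, ?_, hv, hu, hw⟩, ?_⟩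
      · rw [← hH, h, hwStab_index hk hl hm]
      · exact h'.trans h.symm
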